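/- arXiv:1505.02878 — 3 statements merged into one kernel-verified Lean document; each statement's English description precedes it below -/
import Mathlib

section
/- Correctness of Optimize: Let (H, ≺) be a Θ-restricted Horn constraint optimization problem. Assume Solve is any procedure such that whenever Solve(H') returns Sol(θ) then θ is a Θ-restricted solution of H', and whenever Solve(H') returns NoSol then H' has no Θ-restricted solution; and assume Improve_≺(θ, H) is an ∃HCCS whose Θ-restricted solutions are exactly the Θ-restricted solutions θ' of H with θ' ≺ θ. Then, whenever the procedure Optimize(H, ≺) terminates and returns OptSol(θ), θ is a Pareto optimal Θ-restricted solution of H with respect to ≺; and whenever it terminates and returns Sol(θ), θ is a (possibly non-Pareto-optimal) Θ-restricted solution of H. -/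
namespace HCCS

/-- Variables of QFLIA formulas. -/
abbrev Var := ℕ

/-- Linear integer terms: `t ::= n | x | t + t | n · t`. -/
inductive Tm : Type
  | const : ℤ → Tm
  | var : Var → Tm
  | add : Tm → Tm → Tm
  | mul : ℤ → Tm → Tm

/-- Evaluation of a term under an assignment. -/
def Tm.eval (σ : Var → ℤ) : Tm → ℤ
  | .const n => n
  | .var x => σ x
  | .add t₁ t₂ => t₁.eval σ + t₂.eval σ
  | .mul n t => n * t.eval σ

/-- Quantifier-free linear integer arithmetic formulas. -/
inductive Fml : Type
  | le : Tm → Tm → Fml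
  | top : Fml
  | bot : Fml
  | not : Fml → Fml
  | and : Fml → Fml → Fml
  | or : Fml → Fml → Fml
  | imp : Fml → Fml → Fml

/-- Satisfaction of a QFLIA formula under an assignment (over ℤ). -/
def Fml.sat (σ : Var → ℤ) : Fml → Prop
  | .le t₁ t₂ => t₁.eval σ ≤ t₂.eval σ
  | .top => True
  | .bot => False
  | .not φ => ¬ φ.sat σ
  | .and φ₁ φ₂ => φ₁.sat σ ∧ φ₂.sat σ
  | .or φ₁ φ₂ => φ₁.sat σ ∨ φ₂.sat σ
  | .imp φ₁ φ₂ => φ₁.sat σ → φ₂.sat σ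

/-- A predicate-variable atom `P(t̄)`, over predicate variables `P₁, …, P_m`
with arities given by `ar`. -/
structure Atom (m : ℕ) (ar : Fin m → ℕ) where
  P : Fin m
  args : Fin (ar P) → Tm

/-- A predicate substitution maps each predicate variable to a closed predicate over ℤ. -/
abbrev PredSub (m : ℕ) (ar : Fin m → ℕ) := (P : Fin m) → ((Fin (ar P) → ℤ) → Prop)

/-- The atom `P(t̄)` holds under `θ` and `σ`. -/
def Atom.holds {m : ℕ} {ar : Fin m → ℕ} (θ : PredSub m ar) (σ : Var → ℤ)
    (a : Atom m ar) : Prop :=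
  θ a.P (fun i => (a.args i).eval σ)

/-- Heads of Horn clauses: `h ::= φ | P(t̄) | ∃x̄.(P(t̄) ∧ φ)`. -/
inductive Head (m : ℕ) (ar : Fin m → ℕ) : Type
  | fml : Fml → Head m ar
  | atom : Atom m ar → Head m ar
  | exi : List Var → Atom m ar → Fml → Head m ar

/-- Satisfaction of a head under `θ` and `σ`. -/
def Head.holds {m : ℕ} {ar : Fin m → ℕ} (θ : PredSub m ar) (σ : Var → ℤ) :
    Head m ar → Prop
  | .fml φ => φ.sat σ
  | .atom a => a.holds θ σ
  | .exi xs a φ => ∃ σ' : Var → ℤ, (∀ y, y ∉ xs → σ' y = σ y) ∧ a.holds θ σ' ∧ φ.sat σ'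

/-- A Horn clause `h ⇐ P₁(t̄₁) ∧ … ∧ P_k(t̄_k) ∧ φ`. -/
structure HClause (m : ℕ) (ar : Fin m → ℕ) where
  head : Head m ar
  batoms : List (Atom m ar)
  bfml : Fml

/-- A clause holds under `θ` if it is valid over ℤ. -/
def HClause.holds {m : ℕ} {ar : Fin m → ℕ} (θ : PredSub m ar) (c : HClause m ar) : Prop :=
  ∀ σ : Var → ℤ, (∀ a ∈ c.batoms, a.holds θ σ) → c.bfml.sat σ → c.head.holds θ σ

/-- `θ` is a solution of the ∃HCCS `H`. -/
def IsSolution {m : ℕ} {ar : Fin m → ℕ} (θ : PredSub m ar) (H : List (HClause m ar)) : Prop :=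
  ∀ c ∈ H, c.holds θ

/-- An atomic predicate `λx₁,…,x_k. n₀ + Σᵢ nᵢ·xᵢ ≥ 0`. -/
def AtomicPred {k : ℕ} (p : (Fin k → ℤ) → Prop) : Prop :=
  ∃ (n₀ : ℤ) (c : Fin k → ℤ), p = fun x => 0 ≤ n₀ + ∑ i, c i * x i

/-- `θ ∈ Θ_atom`: every predicate variable is mapped to an atomic predicate. -/
def InThetaAtom {m : ℕ} {ar : Fin m → ℕ} (θ : PredSub m ar) : Prop :=
  ∀ P, AtomicPred (θ P)

/-- Optimization directions. -/
inductive Dir : Type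
  | max
  | min

/-- `p₁ ⪯_MAX p₂` iff `p₂ ⊆ p₁`; `p₁ ⪯_MIN p₂` iff `p₁ ⊆ p₂`. -/
def predLe (d : Dir) {k : ℕ} (p q : (Fin k → ℤ) → Prop) : Prop :=
  match d with
  | .max => ∀ x, q x → p x
  | .min => ∀ x, p x → q x

/-- `p₁ ≺_d p₂`. -/
def predLt (d : Dir) {k : ℕ} (p q : (Fin k → ℤ) → Prop) : Prop :=
  predLe d p q ∧ ¬ predLe d q p

/-- `p₁ ≡_d p₂`. -/
def predEquiv (d : Dir) {k : ℕ} (p q : (Fin k → ℤ) → Prop) : Prop :=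
  predLe d p q ∧ predLe d q p

/-- The lexicographic strict order `θ₁ ≺_{(ρ,⊑)} θ₂` on predicate substitutions,
where the priority order `⊑` is `P₁ ⊑ … ⊑ P_m` (the order of the indices `Fin m`). -/
def precSub {m : ℕ} {ar : Fin m → ℕ} (ρ : Fin m → Dir) (θ₁ θ₂ : PredSub m ar) : Prop :=
  ∃ i : Fin m, predLt (ρ i) (θ₁ i) (θ₂ i) ∧ ∀ j : Fin m, j < i → predEquiv (ρ j) (θ₁ j) (θ₂ j)

end HCCS

namespace HCCS

/-- Possible results of the sub-procedure `Solve`. -/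
inductive SolveRes (m : ℕ) (ar : Fin m → ℕ) : Type
  | unknown : SolveRes m ar
  | nosol : SolveRes m ar
  | sol : PredSub m ar → SolveRes m ar

/-- Possible results of the procedure `Optimize`. -/
inductive OptRes (m : ℕ) (ar : Fin m → ℕ) : Type
  | unknown : OptRes m ar
  | nosol : OptRes m ar
  | sol : PredSub m ar → OptRes m ar
  | optsol : PredSub m ar → OptRes m ar

/-- The improvement loop of `Optimize`: starting from the current solution `θ`,
compute `H' := Improve_≺(θ, H)` and call `Solve(H')`; on `Unknown` return `Sol(θ)`,
on `NoSol` return `OptSol(θ)`, and on `Sol(θ')` continue with `θ'`. -/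
inductive LoopRet {m : ℕ} {ar : Fin m → ℕ}
    (Solve : List (HClause m ar) → SolveRes m ar)
    (Improve : PredSub m ar → List (HClause m ar) → List (HClause m ar))
    (H : List (HClause m ar)) : PredSub m ar → OptRes m ar → Prop
  | retUnknown {θ} : Solve (Improve θ H) = SolveRes.unknown → LoopRet Solve Improve H θ (OptRes.sol θ)
  | retNoSol {θ} : Solve (Improve θ H) = SolveRes.nosol → LoopRet Solve Improve H θ (OptRes.optsol θ)
  | next {θ θ' r} : Solve (Improve θ H) = SolveRes.sol θ' →
      LoopRet Solve Improve H θ' r → LoopRet Solve Improve H θ r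

/-- `Optimize(H, ≺)` terminates with result `r`: it calls `Solve(H)`; on `Unknown`/`NoSol`
it returns `Unknown`/`NoSol`; on `Sol(θ₀)` it enters the improvement loop from `θ₀`. -/
def OptimizeReturns {m : ℕ} {ar : Fin m → ℕ}
    (Solve : List (HClause m ar) → SolveRes m ar)
    (Improve : PredSub m ar → List (HClause m ar) → List (HClause m ar))
    (H : List (HClause m ar)) (r : OptRes m ar) : Prop :=
  (Solve H = SolveRes.unknown ∧ r = OptRes.unknown) ∨
  (Solve H = SolveRes.nosol ∧ r = OptRes.nosol) ∨
  (∃ θ₀, Solve H = SolveRes.sol θ₀ ∧ LoopRet Solve Improve H θ₀ r)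

end HCCS

namespace HCCS

variable {m : ℕ} {ar : Fin m → ℕ}
  {Solve : List (HClause m ar) → SolveRes m ar}
  {Improve : PredSub m ar → List (HClause m ar) → List (HClause m ar)}
  {H : List (HClause m ar)} {r : OptRes m ar}

/-- If every substitution found by `Solve`, on `H` or in an improvement step, satisfies `I`,
then so does the substitution returned by `Optimize`; when the result is `OptSol(θ)`,
`Solve` moreover reported `NoSol` on `Improve_≺(θ, H)`. -/
theorem OptimizeReturns.exists_final {I : PredSub m ar → Prop}
    (hinit : ∀ θ, Solve H = .sol θ → I θ)
    (hstep : ∀ θ θ', Solve (Improve θ H) = .sol θ' → I θ')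
    (h : OptimizeReturns Solve Improve H r) :
    r = .unknown ∨ r = .nosol ∨
      ∃ θ, I θ ∧ (r = .sol θ ∨ r = .optsol θ ∧ Solve (Improve θ H) = .nosol) := by
  rcases h with ⟨-, hr⟩ | ⟨-, hr⟩ | ⟨θ₀, h₀, hloop⟩
  · exact .inl hr
  · exact .inr (.inl hr)
  · refine .inr (.inr ?_)
    have hI := hinit θ₀ h₀
    clear h₀
    induction hloop with
    | retUnknown _ => exact ⟨_, hI, .inl rfl⟩
    | retNoSol h => exact ⟨_, hI, .inr ⟨rfl, h⟩⟩
    | next h _ ih => exact ih (hstep _ _ h)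

end HCCS

open HCCS in
/-- Correctness of the procedure `Optimize` for a `Θ`-restricted Horn constraint
optimization problem `(H, ≺)`: if `Solve` is correct for `Θ`-restricted solving and
`Improve_≺(θ, H)` has as its `Θ`-restricted solutions exactly the `Θ`-restricted
solutions `θ'` of `H` with `θ' ≺ θ`, then a returned `OptSol(θ)` is a Pareto optimal
`Θ`-restricted solution of `H` w.r.t. `≺`, and a returned `Sol(θ)` is a (possibly
non-Pareto-optimal) `Θ`-restricted solution of `H`. -/
theorem optimize_correct
    (m : ℕ) (ar : Fin m → ℕ) (H : List (HClause m ar))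
    (Θ : Set (PredSub m ar))
    (prec : PredSub m ar → PredSub m ar → Prop)
    (hIrr : ∀ θ, ¬ prec θ θ)
    (hTrans : ∀ θ₁ θ₂ θ₃, prec θ₁ θ₂ → prec θ₂ θ₃ → prec θ₁ θ₃)
    (Solve : List (HClause m ar) → SolveRes m ar)
    (hSolveSol : ∀ (H' : List (HClause m ar)) (θ : PredSub m ar),
      Solve H' = SolveRes.sol θ → θ ∈ Θ ∧ IsSolution θ H')
    (hSolveNoSol : ∀ H' : List (HClause m ar),
      Solve H' = SolveRes.nosol → ¬ ∃ θ ∈ Θ, IsSolution θ H')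
    (Improve : PredSub m ar → List (HClause m ar) → List (HClause m ar))
    (hImprove : ∀ θ θ' : PredSub m ar,
      (θ' ∈ Θ ∧ IsSolution θ' (Improve θ H)) ↔ (θ' ∈ Θ ∧ IsSolution θ' H ∧ prec θ' θ)) :
    (∀ θ : PredSub m ar, OptimizeReturns Solve Improve H (OptRes.optsol θ) →
      θ ∈ Θ ∧ IsSolution θ H ∧ ∀ θ' ∈ Θ, IsSolution θ' H → ¬ prec θ' θ) ∧
    (∀ θ : PredSub m ar, OptimizeReturns Solve Improve H (OptRes.sol θ) →
      θ ∈ Θ ∧ IsSolution θ H) := by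
  have hfinal {r} (h : OptimizeReturns Solve Improve H r) :=
    h.exists_final (I := fun θ => θ ∈ Θ ∧ IsSolution θ H) (hSolveSol H) fun θ θ' hs =>
      have h' := (hImprove θ θ').1 (hSolveSol _ _ hs)
      ⟨h'.1, h'.2.1⟩
  refine ⟨fun θ h => ?_, fun θ h => ?_⟩
  · obtain h | h | ⟨θ₁, hI, h | ⟨h, hno⟩⟩ := hfinal h <;> cases h
    exact ⟨hI.1, hI.2, fun θ' hΘ hsol hprec =>
      hSolveNoSol _ hno ⟨θ', (hImprove θ θ').2 ⟨hΘ, hsol, hprec⟩⟩⟩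
  · obtain h | h | ⟨θ₁, hI, h | ⟨h, -⟩⟩ := hfinal h <;> cases h
    exact hI
end

section
/- Parallelism of nested integer half-spaces: Let n ≥ 1, a₁, a₂ ∈ ℤⁿ and c₁, c₂ ∈ ℤ. If H(a₁, c₁) ⊆ H(a₂, c₂), H(a₁, c₁) ≠ ∅, and H(a₂, c₂) ≠ ℤⁿ, then there exist positive integers p and q such that p • a₁ = q • a₂ (the normal vectors are positive rational multiples of each other; in particular the two half-spaces are parallel). -/
/-- If an integer half-space is nonempty and contained in another one, then every direction
that is nonnegative on the first normal vector is nonnegative on the second. -/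
theorem dotProduct_nonneg_of_halfspace_subset {ι : Type*} [Fintype ι]
    {a₁ a₂ : ι → ℤ} {c₁ c₂ : ℤ}
    (hsub : ∀ x : ι → ℤ, 0 ≤ a₁ ⬝ᵥ x + c₁ → 0 ≤ a₂ ⬝ᵥ x + c₂)
    {x₀ : ι → ℤ} (hx₀ : 0 ≤ a₁ ⬝ᵥ x₀ + c₁) {d : ι → ℤ} (hd : 0 ≤ a₁ ⬝ᵥ d) :
    0 ≤ a₂ ⬝ᵥ d := by
  by_contra! hneg
  have hmem := hsub (x₀ + (|a₂ ⬝ᵥ x₀ + c₂| + 1) • d) (by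
    rw [dotProduct_add, dotProduct_smul, smul_eq_mul]
    have := mul_nonneg (by positivity : 0 ≤ |a₂ ⬝ᵥ x₀ + c₂| + 1) hd
    linarith)
  rw [dotProduct_add, dotProduct_smul, smul_eq_mul] at hmem
  nlinarith [le_abs_self (a₂ ⬝ᵥ x₀ + c₂), abs_nonneg (a₂ ⬝ᵥ x₀ + c₂)]

/-- Parallelism of nested integer half-spaces: if the integer half-space
`H(a₁,c₁) = {x ∈ ℤⁿ | a₁·x + c₁ ≥ 0}` is contained in `H(a₂,c₂)`, is nonempty,
and `H(a₂,c₂)` is proper, then the normal vectors `a₁` and `a₂` are positive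
rational multiples of each other: `p • a₁ = q • a₂` for some positive integers `p, q`. -/
theorem nested_halfspaces_parallel (n : ℕ) (hn : 1 ≤ n)
    (a₁ a₂ : Fin n → ℤ) (c₁ c₂ : ℤ)
    (hsub : {x : Fin n → ℤ | 0 ≤ (∑ i, a₁ i * x i) + c₁} ⊆
            {x : Fin n → ℤ | 0 ≤ (∑ i, a₂ i * x i) + c₂})
    (hne : {x : Fin n → ℤ | 0 ≤ (∑ i, a₁ i * x i) + c₁}.Nonempty)
    (hproper : {x : Fin n → ℤ | 0 ≤ (∑ i, a₂ i * x i) + c₂} ≠ Set.univ) :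
    ∃ p q : ℤ, 0 < p ∧ 0 < q ∧ p • a₁ = q • a₂ := by
  change ∀ x : Fin n → ℤ, 0 ≤ a₁ ⬝ᵥ x + c₁ → 0 ≤ a₂ ⬝ᵥ x + c₂ at hsub
  obtain ⟨x₀, hx₀⟩ := hne
  change 0 ≤ a₁ ⬝ᵥ x₀ + c₁ at hx₀
  obtain ⟨y, hy⟩ := (Set.ne_univ_iff_exists_notMem _).mp hproper
  change ¬ 0 ≤ a₂ ⬝ᵥ y + c₂ at hy
  have hdir : ∀ d : Fin n → ℤ, 0 ≤ a₁ ⬝ᵥ d → 0 ≤ a₂ ⬝ᵥ d := fun d hd =>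
    dotProduct_nonneg_of_halfspace_subset hsub hx₀ hd
  have ha₁ : a₁ ≠ 0 := by
    rintro rfl
    exact hy (hsub y (by simpa using hx₀))
  have ha₂ : a₂ ≠ 0 := by
    rintro rfl
    exact hy (by simpa using hsub x₀ hx₀)
  have hq_nonneg : 0 ≤ a₁ ⬝ᵥ a₁ := Finset.sum_nonneg fun i _ => mul_self_nonneg (a₁ i)
  have hq : 0 < a₁ ⬝ᵥ a₁ :=
    lt_of_le_of_ne hq_nonneg fun h => ha₁ (dotProduct_self_eq_zero.mp h.symm)
  have hp_nonneg : 0 ≤ a₂ ⬝ᵥ a₁ := hdir a₁ hq_nonneg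
  -- The component of `a₂` orthogonal to `a₁`, cleared of denominators, vanishes.
  have hpar : (a₂ ⬝ᵥ a₁) • a₁ = (a₁ ⬝ᵥ a₁) • a₂ := by
    set d := (a₂ ⬝ᵥ a₁) • a₁ - (a₁ ⬝ᵥ a₁) • a₂ with hd
    have h₁ : a₁ ⬝ᵥ d = 0 := by
      rw [hd, dotProduct_sub, dotProduct_smul, dotProduct_smul, dotProduct_comm a₁ a₂,
        smul_eq_mul, smul_eq_mul]
      ring
    have h₂ : a₂ ⬝ᵥ d = 0 := by
      have hpos := hdir d h₁.ge
      have hneg := hdir (-d) (by rw [dotProduct_neg, h₁, neg_zero])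
      rw [dotProduct_neg] at hneg
      linarith
    have hdd : d ⬝ᵥ d = 0 := by
      conv_lhs => rw [hd]
      rw [sub_dotProduct, smul_dotProduct, smul_dotProduct, ← hd, h₁, h₂]
      simp
    exact sub_eq_zero.mp (dotProduct_self_eq_zero.mp hdd)
  refine ⟨a₂ ⬝ᵥ a₁, a₁ ⬝ᵥ a₁, lt_of_le_of_ne hp_nonneg fun h => ?_, hq, hpar⟩
  rw [← h, zero_smul] at hpar
  exact (smul_ne_zero hq.ne' ha₂) hpar.symm
end

section
/- Limit of a strictly decreasing chain of integer half-spaces: Let n ≥ 1 and let (H_k)_{k ∈ ℕ} be a sequence of integer half-spaces in ℤⁿ such that H_{k+1} ⊊ H_k for every k. Then ⋂_{k ∈ ℕ} H_k = ∅. -/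
section HalfSpace

variable {M : Type*} [AddCommGroup M] {f g : M →+ ℤ} {b c : ℤ}

/-- An inclusion of nonempty half-spaces induces an inclusion of the recession cones. -/
theorem nonneg_of_halfspace_subset {p : M} (hp : 0 ≤ g p + c)
    (h : ∀ x, 0 ≤ g x + c → 0 ≤ f x + b) {d : M} (hd : 0 ≤ g d) : 0 ≤ f d := by
  by_contra! hf
  have hx := h (p + ((f p + b).natAbs + 1) • d) (by
    simp only [map_add, map_nsmul, nsmul_eq_mul]
    have : 0 ≤ (((f p + b).natAbs + 1 : ℕ) : ℤ) * g d := by positivity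
    linarith)
  simp only [map_add, map_nsmul, nsmul_eq_mul] at hx
  push_cast at hx
  nlinarith [le_abs_self (f p + b), abs_nonneg (f p + b)]

/-- If `g d ≥ 0` implies `f d ≥ 0` and `f` takes a negative value, then the converse
implication holds as well. -/
theorem nonneg_of_nonneg_imp (h : ∀ d, 0 ≤ g d → 0 ≤ f d) {e : M} (he : f e < 0) {d : M}
    (hd : 0 ≤ f d) : 0 ≤ g d := by
  by_contra! hg
  have hneg := h (-d) (by rw [map_neg]; omega)
  rw [map_neg] at hneg
  have hfd : f d = 0 := by omega
  have hx := h (e - (g e).natAbs • d) (by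
    simp only [map_sub, map_nsmul, nsmul_eq_mul, Int.natCast_natAbs]
    nlinarith [neg_abs_le (g e), abs_nonneg (g e)])
  simp only [map_sub, map_nsmul, hfd, smul_zero] at hx
  omega

/-- There is no strictly decreasing sequence of integer half-spaces with a common point. -/
theorem false_of_strict_halfspace_chain {a : ℕ → M →+ ℤ} {c : ℕ → ℤ} {p : M}
    (hchain : StrictAnti fun k ↦ {x | 0 ≤ a k x + c k}) (hp : ∀ k, 0 ≤ a k p + c k) :
    False := by
  have hex (k : ℕ) : ∃ x, 0 ≤ a k x + c k ∧ a (k + 1) x + c (k + 1) < 0 := by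
    obtain ⟨x, hx, hx'⟩ := Set.exists_of_ssubset (hchain k.lt_succ_self)
    exact ⟨x, hx, not_le.mp hx'⟩
  choose x hx hx' using hex
  have he : a 1 (x 0 - p) < 0 := by
    have := hx' 0
    have := hp 1
    simp only [zero_add, map_sub] at *
    omega
  have hcone (k : ℕ) {d : M} (hd : 0 ≤ a 1 d) : 0 ≤ a (k + 1) d :=
    nonneg_of_nonneg_imp (fun _ ↦ nonneg_of_halfspace_subset (hp (k + 1))
      fun _ hy ↦ hchain.antitone (Nat.le_add_left 1 k) hy) he hd
  have hlt (k : ℕ) {y : M} (hy : 0 ≤ a (k + 1) y + c (k + 1)) : a 1 (x k) < a 1 y := by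
    by_contra! hle
    have := hcone k (d := x k - y) (by rw [map_sub]; omega)
    have := hx' k
    rw [map_sub] at *
    omega
  have hgrow (k : ℕ) : a 1 (x 0) + k ≤ a 1 (x k) := by
    induction k with
    | zero => simp
    | succ k ih =>
      have := hlt k (hx (k + 1))
      push_cast
      omega
  have := hgrow (a 1 p - a 1 (x 0)).natAbs
  have := hlt (a 1 p - a 1 (x 0)).natAbs (hp _)
  omega

end HalfSpace

/-- Limit of a strictly decreasing chain of integer half-spaces: if
`H_k = {x ∈ ℤⁿ | a_k·x + c_k ≥ 0}` satisfies `H_{k+1} ⊊ H_k` for every `k`,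
then `⋂_k H_k = ∅`. -/
theorem decreasing_halfspace_chain_inter_empty (n : ℕ) (hn : 1 ≤ n)
    (a : ℕ → Fin n → ℤ) (c : ℕ → ℤ)
    (hchain : ∀ k : ℕ,
      {x : Fin n → ℤ | 0 ≤ (∑ i, a (k + 1) i * x i) + c (k + 1)} ⊂
      {x : Fin n → ℤ | 0 ≤ (∑ i, a k i * x i) + c k}) :
    (⋂ k : ℕ, {x : Fin n → ℤ | 0 ≤ (∑ i, a k i * x i) + c k}) = ∅ := by
  refine Set.eq_empty_of_forall_notMem fun p hp ↦ ?_
  rw [Set.mem_iInter] at hp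
  let φ (k : ℕ) : (Fin n → ℤ) →+ ℤ :=
    AddMonoidHom.mk' (fun x ↦ ∑ i, a k i * x i) (dotProduct_add (a k))
  exact false_of_strict_halfspace_chain (a := φ) (strictAnti_nat_of_succ_lt hchain) hp
end
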